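/- Let Ψ and Φ be unit vectors in H = ℂ^{d_A} ⊗ ℂ^{d_B}, let α, β ∈ ℂ with |α|² + |β|² = 1 be such that Γ = αΨ + βΦ ≠ 0, and set ρ^A = |α|² Tr_B|Ψ⟩⟨Ψ| + |β|² Tr_B|Φ⟩⟨Φ| and ρ^B = |α|² Tr_A|Ψ⟩⟨Ψ| + |β|² Tr_A|Φ⟩⟨Φ|. Then ‖Γ‖² · E(Γ) ≤ 2[ |α|²E(Ψ) + |β|²E(Φ) + h₂(|α|²) − |S(ρ^A) − S(ρ^B)| ]. -/

import Mathlib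

open scoped BigOperators

noncomputable section

namespace EoS

/-- Vectors of `ℂ^{dA} ⊗ ℂ^{dB}`, modeled as `EuclideanSpace ℂ (Fin dA × Fin dB)`. -/
abbrev TensorSpace (dA dB : ℕ) := EuclideanSpace ℂ (Fin dA × Fin dB)

variable {dA dB : ℕ}

/-- The rank-one operator `|ψ⟩⟨ψ| = ψ ψ†`, as a matrix. -/
def ketbra (ψ : TensorSpace dA dB) : Matrix (Fin dA × Fin dB) (Fin dA × Fin dB) ℂ :=
  fun p q => ψ p * (starRingEnd ℂ) (ψ q)

/-- Partial trace over the `B` system. -/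
def trB (ρ : Matrix (Fin dA × Fin dB) (Fin dA × Fin dB) ℂ) : Matrix (Fin dA) (Fin dA) ℂ :=
  fun a a' => ∑ b : Fin dB, ρ (a, b) (a', b)

/-- Partial trace over the `A` system. -/
def trA (ρ : Matrix (Fin dA × Fin dB) (Fin dA × Fin dB) ℂ) : Matrix (Fin dB) (Fin dB) ℂ :=
  fun b b' => ∑ a : Fin dA, ρ (a, b) (a, b')

open scoped Classical in
/-- Von Neumann entropy (base-2), via eigenvalues; junk value `0` on non-Hermitian input. -/
def vnEntropy {n : Type*} [Fintype n] [DecidableEq n] (ρ : Matrix n n ℂ) : ℝ :=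
  if h : ρ.IsHermitian then -∑ i, (h.eigenvalues i) * Real.logb 2 (h.eigenvalues i) else 0

/-- Entropy of entanglement of a (unit) vector. -/
def ent (ψ : TensorSpace dA dB) : ℝ := vnEntropy (trB (ketbra ψ))

/-- Entropy of entanglement of a nonzero, not necessarily normalized, vector. -/
def entN (ψ : TensorSpace dA dB) : ℝ := ent ((‖ψ‖ : ℝ)⁻¹ • ψ)

/-- Binary entropy (base 2). -/
def h2 (x : ℝ) : ℝ := -x * Real.logb 2 x - (1 - x) * Real.logb 2 (1 - x)

/-- Elementary tensor `u ⊗ w`. -/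
def tensor (u : EuclideanSpace ℂ (Fin dA)) (w : EuclideanSpace ℂ (Fin dB)) :
    TensorSpace dA dB := WithLp.toLp 2 (fun p => u p.1 * w p.2)

/-- One-sided orthogonality on the `B` side:
`Tr[Tr_A(|Ψ⟩⟨Ψ|) ⬝ Tr_A(|Φ⟩⟨Φ|)] = 0`. -/
def OneSidedOrthB (Ψ Φ : TensorSpace dA dB) : Prop :=
  Matrix.trace (trA (ketbra Ψ) * trA (ketbra Φ)) = 0


open Matrix in
/-- The (natural log) entropy functional, through the roots of the characteristic polynomial. -/
def entT {n : Type*} [Fintype n] [DecidableEq n] (M : Matrix n n ℂ) : ℝ :=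
  (M.charpoly.roots.map (fun z => Real.negMulLog z.re)).sum

section aux

open Matrix
open scoped ComplexOrder

variable {m n : Type*} [Fintype m] [DecidableEq m] [Fintype n] [DecidableEq n]

lemma entT_eq {M : Matrix n n ℂ} (h : M.IsHermitian) :
    entT M = ∑ i, Real.negMulLog (h.eigenvalues i) := by
  rw [entT, h.roots_charpoly_eq_eigenvalues, Multiset.map_map]
  simp

lemma vnEntropy_eq {M : Matrix n n ℂ} (h : M.IsHermitian) :
    vnEntropy M = entT M / Real.log 2 := by
  rw [vnEntropy, dif_pos h, entT_eq h, Finset.sum_div, ← Finset.sum_neg_distrib]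
  refine Finset.sum_congr rfl fun i _ => ?_
  simp only [Real.negMulLog, Real.logb]
  ring

lemma entT_mul_comm (A : Matrix m n ℂ) (B : Matrix n m ℂ) : entT (A * B) = entT (B * A) := by
  have h := Matrix.charpoly_mul_comm' A B
  have h1 := congrArg (fun p : Polynomial ℂ =>
    (p.roots.map (fun z => Real.negMulLog z.re)).sum) h
  rw [Polynomial.roots_mul (mul_ne_zero (pow_ne_zero _ Polynomial.X_ne_zero)
      (Matrix.charpoly_monic _).ne_zero),
    Polynomial.roots_mul (mul_ne_zero (pow_ne_zero _ Polynomial.X_ne_zero)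
      (Matrix.charpoly_monic _).ne_zero)] at h1
  simpa [entT, Multiset.map_nsmul, Multiset.sum_nsmul] using h1

lemma entT_transpose (A : Matrix n n ℂ) : entT Aᵀ = entT A := by
  simp [entT, Matrix.charpoly_transpose]

lemma diag_eq {M : Matrix n n ℂ} (h : M.IsHermitian) (i : n) :
    (M i i).re = ∑ j, ‖(h.eigenvectorUnitary : Matrix n n ℂ) i j‖ ^ 2 * h.eigenvalues j := by
  conv_lhs => rw [h.spectral_theorem, Unitary.conjStarAlgAut_apply]
  rw [Matrix.mul_apply, Complex.re_sum]
  refine Finset.sum_congr rfl fun j _ => ?_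
  rw [Matrix.mul_diagonal, Matrix.star_apply]
  generalize (h.eigenvectorUnitary : Matrix n n ℂ) i j = z
  simp only [Function.comp, RCLike.star_def]
  rw [mul_right_comm, Complex.mul_conj, Complex.normSq_eq_norm_sq]
  exact Complex.re_ofReal_mul (‖z‖ ^ 2) _

lemma unitary_row (U : Matrix.unitaryGroup n ℂ) (i : n) :
    ∑ j, ‖(U : Matrix n n ℂ) i j‖ ^ 2 = 1 := by
  have h := congrFun (congrFun (Matrix.mem_unitaryGroup_iff.mp U.2) i) i
  rw [Matrix.mul_apply, Matrix.one_apply_eq] at h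
  have h2 := congrArg Complex.re h
  rw [Complex.re_sum] at h2
  rw [← Complex.one_re, ← h2]
  refine Finset.sum_congr rfl fun j _ => ?_
  rw [Matrix.star_apply, RCLike.star_def, Complex.mul_conj, Complex.normSq_eq_norm_sq,
    Complex.ofReal_re]

lemma unitary_col (U : Matrix.unitaryGroup n ℂ) (j : n) :
    ∑ i, ‖(U : Matrix n n ℂ) i j‖ ^ 2 = 1 := by
  have h := unitary_row (star U) j
  simpa [Matrix.star_apply] using h

/-- Measuring in a fixed basis does not decrease entropy. -/
lemma entT_le_diag {M : Matrix n n ℂ} (h : M.PosSemidef) :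
    entT M ≤ ∑ i, Real.negMulLog (M i i).re := by
  rw [entT_eq h.1]
  calc ∑ j, Real.negMulLog (h.1.eigenvalues j)
      = ∑ j, ∑ i, ‖(h.1.eigenvectorUnitary : Matrix n n ℂ) i j‖ ^ 2 *
          Real.negMulLog (h.1.eigenvalues j) := by
        refine Finset.sum_congr rfl fun j _ => ?_
        rw [← Finset.sum_mul, unitary_col, one_mul]
    _ = ∑ i, ∑ j, ‖(h.1.eigenvectorUnitary : Matrix n n ℂ) i j‖ ^ 2 *
          Real.negMulLog (h.1.eigenvalues j) := Finset.sum_comm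
    _ ≤ _ := by
        refine Finset.sum_le_sum fun i _ => ?_
        rw [diag_eq h.1]
        have := Real.concaveOn_negMulLog.le_map_sum (t := Finset.univ)
          (w := fun j => ‖(h.1.eigenvectorUnitary : Matrix n n ℂ) i j‖ ^ 2)
          (p := h.1.eigenvalues) (fun _ _ => by positivity) (unitary_row _ i)
          (fun j _ => h.eigenvalues_nonneg j)
        simpa using this

lemma posSemidef_comb {X Y : Matrix n n ℂ} (hX : X.PosSemidef) (hY : Y.PosSemidef)
    {p q : ℝ} (hp : 0 ≤ p) (hq : 0 ≤ q) : (p • X + q • Y).PosSemidef := 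
  (hX.smul hp).add (hY.smul hq)

lemma entT_concave {X Y : Matrix n n ℂ} (hX : X.PosSemidef) (hY : Y.PosSemidef)
    {p q : ℝ} (hp : 0 ≤ p) (hq : 0 ≤ q) (hpq : p + q = 1) :
    p * entT X + q * entT Y ≤ entT (p • X + q • Y) := by
  have hZ := posSemidef_comb hX hY hp hq
  set U : Matrix n n ℂ := (hZ.1.eigenvectorUnitary : Matrix n n ℂ) with hU
  have hUU : U * Uᴴ = 1 := Matrix.mem_unitaryGroup_iff.mp hZ.1.eigenvectorUnitary.2
  have hconj : ∀ W : Matrix n n ℂ, entT W = entT (Uᴴ * W * U) := fun W => by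
    rw [Matrix.mul_assoc, entT_mul_comm, Matrix.mul_assoc, hUU, Matrix.mul_one]
  have hD : Uᴴ * (p • X + q • Y) * U = diagonal (RCLike.ofReal ∘ hZ.1.eigenvalues) := by
    have := hZ.1.conjStarAlgAut_star_eigenvectorUnitary
    rw [Unitary.conjStarAlgAut_apply] at this
    simpa [Matrix.star_eq_conjTranspose, ← hU] using this
  have hent : ∀ i, hZ.1.eigenvalues i
      = p * ((Uᴴ * X * U) i i).re + q * ((Uᴴ * Y * U) i i).re := fun i => by
    have h1 := congrArg Complex.re (congrFun (congrFun hD i) i)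
    rw [Matrix.mul_add, Matrix.add_mul] at h1
    simpa using h1.symm
  have hX' : (Uᴴ * X * U).PosSemidef := hX.conjTranspose_mul_mul_same U
  have hY' : (Uᴴ * Y * U).PosSemidef := hY.conjTranspose_mul_mul_same U
  rw [entT_eq hZ.1, hconj X, hconj Y]
  calc _ ≤ p * (∑ i, Real.negMulLog ((Uᴴ * X * U) i i).re)
        + q * (∑ i, Real.negMulLog ((Uᴴ * Y * U) i i).re) :=
        add_le_add (mul_le_mul_of_nonneg_left (entT_le_diag hX') hp)
          (mul_le_mul_of_nonneg_left (entT_le_diag hY') hq)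
    _ = ∑ i, (p * Real.negMulLog ((Uᴴ * X * U) i i).re
        + q * Real.negMulLog ((Uᴴ * Y * U) i i).re) := by
        rw [Finset.mul_sum, Finset.mul_sum, Finset.sum_add_distrib]
    _ ≤ _ := by
        refine Finset.sum_le_sum fun i _ => ?_
        rw [hent]
        have h1 : 0 ≤ ((Uᴴ * X * U) i i).re := (Complex.nonneg_iff.mp hX'.diag_nonneg).1
        have h2 : 0 ≤ ((Uᴴ * Y * U) i i).re := (Complex.nonneg_iff.mp hY'.diag_nonneg).1
        simpa using Real.concaveOn_negMulLog.2 h1 h2 hp hq hpq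

/-- A factorization `p X = C Cᴴ` with `Cᴴ C` diagonal. -/
lemma exists_factor {X : Matrix n n ℂ} (hX : X.PosSemidef) {p : ℝ} (hp : 0 ≤ p) :
    ∃ C : Matrix n n ℂ, C * Cᴴ = p • X ∧
      ∀ i, (Cᴴ * C) i i = ((p * hX.1.eigenvalues i : ℝ) : ℂ) := by
  set U : Matrix n n ℂ := (hX.1.eigenvectorUnitary : Matrix n n ℂ) with hU
  have hUU : Uᴴ * U = 1 := Matrix.mem_unitaryGroup_iff'.mp hX.1.eigenvectorUnitary.2
  set D : Matrix n n ℂ := diagonal (fun i => ((√(p * hX.1.eigenvalues i) : ℝ) : ℂ)) with hDdef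
  have hDH : Dᴴ = D := by
    rw [hDdef, diagonal_conjTranspose]
    congr 1
    ext i
    simp
  have hDD : D * D = diagonal (fun i => ((p * hX.1.eigenvalues i : ℝ) : ℂ)) := by
    rw [hDdef, diagonal_mul_diagonal]
    congr 1
    ext i
    rw [← Complex.ofReal_mul, Real.mul_self_sqrt (mul_nonneg hp (hX.eigenvalues_nonneg i))]
  refine ⟨U * D, ?_, fun i => ?_⟩
  · have hs := hX.1.spectral_theorem
    rw [Unitary.conjStarAlgAut_apply] at hs
    conv_rhs => rw [hs]
    rw [conjTranspose_mul, hDH, Matrix.mul_assoc, ← Matrix.mul_assoc D, hDD]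
    have : diagonal (fun i => ((p * hX.1.eigenvalues i : ℝ) : ℂ))
        = p • diagonal ((RCLike.ofReal : ℝ → ℂ) ∘ hX.1.eigenvalues) := by
      rw [← diagonal_smul]
      congr 1
      ext i
      simp
    rw [this]
    simp [← Matrix.mul_assoc, hU, Matrix.star_eq_conjTranspose]
  · rw [conjTranspose_mul, hDH, Matrix.mul_assoc, ← Matrix.mul_assoc Uᴴ, hUU, Matrix.one_mul, hDD]
    simp

lemma sum_eigs {X : Matrix n n ℂ} (hX : X.IsHermitian) :
    ∑ i, hX.eigenvalues i = X.trace.re := by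
  rw [hX.trace_eq_sum_eigenvalues]
  simp

lemma entT_mix {X Y : Matrix n n ℂ} (hX : X.PosSemidef) (hY : Y.PosSemidef)
    (hX1 : X.trace = 1) (hY1 : Y.trace = 1)
    {p q : ℝ} (hp : 0 ≤ p) (hq : 0 ≤ q) :
    entT (p • X + q • Y) ≤ p * entT X + q * entT Y + (Real.negMulLog p + Real.negMulLog q) := by
  obtain ⟨A, hA, hA'⟩ := exists_factor hX hp
  obtain ⟨B, hB, hB'⟩ := exists_factor hY hq
  have h1 : p • X + q • Y = fromCols A B * (fromCols A B)ᴴ := by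
    rw [conjTranspose_fromCols_eq_fromRows_conjTranspose, fromCols_mul_fromRows, hA, hB]
  have h2 : (fromCols A B)ᴴ * fromCols A B = fromBlocks (Aᴴ * A) (Aᴴ * B) (Bᴴ * A) (Bᴴ * B) := by
    rw [conjTranspose_fromCols_eq_fromRows_conjTranspose, fromRows_mul_fromCols]
  have h3 := entT_le_diag (Matrix.posSemidef_conjTranspose_mul_self (fromCols A B))
  rw [h1, entT_mul_comm]
  refine h3.trans (le_of_eq ?_)
  rw [h2, Fintype.sum_sum_type]
  simp only [fromBlocks_apply₁₁, fromBlocks_apply₂₂, hA', hB', Complex.ofReal_re,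
    Real.negMulLog_mul, Finset.sum_add_distrib, ← Finset.sum_mul, ← Finset.mul_sum, sum_eigs,
    hX1, hY1, ← entT_eq, Complex.one_re]
  ring

lemma entT_nonneg {X : Matrix n n ℂ} (hX : X.PosSemidef) (h1 : X.trace.re ≤ 1) : 0 ≤ entT X := by
  rw [entT_eq hX.1]
  refine Finset.sum_nonneg fun i _ => Real.negMulLog_nonneg (hX.eigenvalues_nonneg i) ?_
  refine le_trans ?_ h1
  rw [← sum_eigs hX.1]
  exact Finset.single_le_sum (f := hX.1.eigenvalues) (fun j _ => hX.eigenvalues_nonneg j)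
    (Finset.mem_univ i)

/-- Coefficient matrix of a bipartite vector. -/
def coeffM (ψ : TensorSpace dA dB) : Matrix (Fin dA) (Fin dB) ℂ := fun a b => ψ (a, b)

lemma trB_eq (ψ : TensorSpace dA dB) : trB (ketbra ψ) = coeffM ψ * (coeffM ψ)ᴴ := by
  ext a a'
  simp [trB, ketbra, coeffM, Matrix.mul_apply]

lemma trA_eq (ψ : TensorSpace dA dB) : trA (ketbra ψ) = (coeffM ψ)ᵀ * ((coeffM ψ)ᵀ)ᴴ := by
  ext a a'
  simp [trA, ketbra, coeffM, Matrix.mul_apply]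

lemma trB_psd (ψ : TensorSpace dA dB) : (trB (ketbra ψ)).PosSemidef := by
  rw [trB_eq]; exact posSemidef_self_mul_conjTranspose _

lemma trA_psd (ψ : TensorSpace dA dB) : (trA (ketbra ψ)).PosSemidef := by
  rw [trA_eq]; exact posSemidef_self_mul_conjTranspose _

lemma entT_trA (ψ : TensorSpace dA dB) : entT (trA (ketbra ψ)) = entT (trB (ketbra ψ)) := by
  rw [trB_eq, trA_eq, entT_mul_comm (coeffM ψ), ← entT_transpose ((coeffM ψ)ᴴ * _),
    transpose_mul]
  rfl

lemma trace_trB (ψ : TensorSpace dA dB) : (trB (ketbra ψ)).trace = ((‖ψ‖ ^ 2 : ℝ) : ℂ) := by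
  rw [EuclideanSpace.norm_sq_eq, Fintype.sum_prod_type]
  simp [Matrix.trace, trB, ketbra, Complex.mul_conj, Complex.normSq_eq_norm_sq]

lemma trace_trA (ψ : TensorSpace dA dB) : (trA (ketbra ψ)).trace = ((‖ψ‖ ^ 2 : ℝ) : ℂ) := by
  rw [EuclideanSpace.norm_sq_eq, Fintype.sum_prod_type_right]
  simp [Matrix.trace, trA, ketbra, Complex.mul_conj, Complex.normSq_eq_norm_sq]

lemma ketbra_smul (r : ℝ) (ψ : TensorSpace dA dB) : ketbra (r • ψ) = (r ^ 2) • ketbra ψ := by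
  ext i j
  simp [ketbra]
  ring

lemma ketbra_normalize (ψ : TensorSpace dA dB) :
    ketbra ψ = (‖ψ‖ ^ 2) • ketbra ((‖ψ‖ : ℝ)⁻¹ • ψ) := by
  by_cases h : ψ = 0
  · subst h
    ext i j
    simp [ketbra]
  · rw [ketbra_smul, smul_smul, ← mul_pow, mul_inv_cancel₀ (norm_ne_zero_iff.mpr h)]
    simp

lemma trB_smul (r : ℝ) (ρ : Matrix (Fin dA × Fin dB) (Fin dA × Fin dB) ℂ) :
    trB (r • ρ) = r • trB ρ := by
  ext i j
  simp [trB, Finset.mul_sum]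

lemma trA_smul (r : ℝ) (ρ : Matrix (Fin dA × Fin dB) (Fin dA × Fin dB) ℂ) :
    trA (r • ρ) = r • trA ρ := by
  ext i j
  simp [trA, Finset.mul_sum]

lemma trB_add (ρ σ : Matrix (Fin dA × Fin dB) (Fin dA × Fin dB) ℂ) :
    trB (ρ + σ) = trB ρ + trB σ := by
  ext i j
  simp [trB, Finset.sum_add_distrib]

lemma trA_add (ρ σ : Matrix (Fin dA × Fin dB) (Fin dA × Fin dB) ℂ) :
    trA (ρ + σ) = trA ρ + trA σ := by
  ext i j
  simp [trA, Finset.sum_add_distrib]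

lemma ketbra_par (Ψ Φ : TensorSpace dA dB) (α β : ℂ) :
    (‖α‖ ^ 2 : ℝ) • ketbra Ψ + (‖β‖ ^ 2 : ℝ) • ketbra Φ
      = (1 / 2 : ℝ) • ketbra (α • Ψ + β • Φ) + (1 / 2 : ℝ) • ketbra (α • Ψ - β • Φ) := by
  ext i j
  simp only [ketbra, Matrix.add_apply, Matrix.smul_apply, PiLp.add_apply, PiLp.sub_apply,
    PiLp.smul_apply, Complex.real_smul, smul_eq_mul, map_add, map_sub, map_mul,
    Complex.ofReal_pow]
  rw [← Complex.mul_conj', ← Complex.mul_conj']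
  push_cast
  ring

lemma norm_normalize_le (ψ : TensorSpace dA dB) : ‖(‖ψ‖ : ℝ)⁻¹ • ψ‖ ^ 2 ≤ 1 := by
  by_cases h : ψ = 0
  · simp [h]
  · rw [norm_smul, norm_inv, norm_norm, inv_mul_cancel₀ (norm_ne_zero_iff.mpr h)]
    simp

end aux

/-- Theorem 2 of the paper: improved LPS bound. -/
theorem improved_lps_bound {dA dB : ℕ}
    (Ψ Φ : TensorSpace dA dB) (hΨ : ‖Ψ‖ = 1) (hΦ : ‖Φ‖ = 1)
    (α β : ℂ) (hαβ : ‖α‖ ^ 2 + ‖β‖ ^ 2 = 1) (hΓ : α • Ψ + β • Φ ≠ 0) :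
    ‖α • Ψ + β • Φ‖ ^ 2 * entN (α • Ψ + β • Φ)
      ≤ 2 * (‖α‖ ^ 2 * ent Ψ + ‖β‖ ^ 2 * ent Φ + h2 (‖α‖ ^ 2)
        - |vnEntropy ((‖α‖ ^ 2 : ℝ) • trB (ketbra Ψ) + (‖β‖ ^ 2 : ℝ) • trB (ketbra Φ))
           - vnEntropy ((‖α‖ ^ 2 : ℝ) • trA (ketbra Ψ) + (‖β‖ ^ 2 : ℝ) • trA (ketbra Φ))|) := by
  have hpar : ‖α • Ψ + β • Φ‖ ^ 2 + ‖α • Ψ - β • Φ‖ ^ 2 = 2 := by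
    have := parallelogram_law_with_norm ℂ (α • Ψ) (β • Φ)
    rw [norm_smul, norm_smul, hΨ, hΦ] at this
    nlinarith
  have hk := ketbra_par Ψ Φ α β
  set G := α • Ψ + β • Φ with hG
  set K := α • Ψ - β • Φ with hK
  rw [ketbra_normalize G, ketbra_normalize K, smul_smul, smul_smul] at hk
  set g := (‖G‖ : ℝ)⁻¹ • G with hg
  set k := (‖K‖ : ℝ)⁻¹ • K with hkk
  have hp : (0 : ℝ) ≤ 1 / 2 * ‖G‖ ^ 2 := by positivity
  have hq : (0 : ℝ) ≤ 1 / 2 * ‖K‖ ^ 2 := by positivity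
  have hpq : 1 / 2 * ‖G‖ ^ 2 + 1 / 2 * ‖K‖ ^ 2 = 1 := by linarith
  have hkB := congrArg trB hk
  have hkA := congrArg trA hk
  simp only [trB_add, trB_smul] at hkB
  simp only [trA_add, trA_smul] at hkA
  have hk0 : 0 ≤ entT (trB (ketbra k)) := by
    refine entT_nonneg (trB_psd k) ?_
    rw [trace_trB, Complex.ofReal_re]
    exact norm_normalize_le K
  have loB := entT_concave (trB_psd g) (trB_psd k) hp hq hpq
  have loA := entT_concave (trA_psd g) (trA_psd k) hp hq hpq
  rw [← hkB] at loB
  rw [← hkA, entT_trA, entT_trA] at loA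
  have ha : (0 : ℝ) ≤ ‖α‖ ^ 2 := by positivity
  have hb : (0 : ℝ) ≤ ‖β‖ ^ 2 := by positivity
  have upB := entT_mix (trB_psd Ψ) (trB_psd Φ) (by simp [trace_trB, hΨ])
    (by simp [trace_trB, hΦ]) ha hb
  have upA := entT_mix (trA_psd Ψ) (trA_psd Φ) (by simp [trace_trA, hΨ])
    (by simp [trace_trA, hΦ]) ha hb
  rw [entT_trA, entT_trA] at upA
  have hkq := mul_nonneg hq hk0
  have hl : 0 < Real.log 2 := Real.log_pos (by norm_num)
  have hh : h2 (‖α‖ ^ 2)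
      = (Real.negMulLog (‖α‖ ^ 2) + Real.negMulLog (‖β‖ ^ 2)) / Real.log 2 := by
    have : 1 - ‖α‖ ^ 2 = ‖β‖ ^ 2 := by linarith
    rw [h2, this]
    simp only [Real.negMulLog, Real.logb]
    ring
  rw [entN, ent, ent, ent, hh, ← hg, vnEntropy_eq (trB_psd g).1, vnEntropy_eq (trB_psd Ψ).1,
    vnEntropy_eq (trB_psd Φ).1,
    vnEntropy_eq (posSemidef_comb (trB_psd Ψ) (trB_psd Φ) ha hb).1,
    vnEntropy_eq (posSemidef_comb (trA_psd Ψ) (trA_psd Φ) ha hb).1,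
    ← sub_div, abs_div, abs_of_pos hl]
  rw [← mul_le_mul_iff_of_pos_right hl]
  field_simp
  rcases abs_cases (entT ((‖α‖ ^ 2 : ℝ) • trB (ketbra Ψ) + (‖β‖ ^ 2 : ℝ) • trB (ketbra Φ))
    - entT ((‖α‖ ^ 2 : ℝ) • trA (ketbra Ψ) + (‖β‖ ^ 2 : ℝ) • trA (ketbra Φ))) with h | h <;>
  · rw [h.1]
    linarith

end EoS
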